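/- Let 1 ≤ p < q ≤ r and b, b′ ∈ 𝔞, and set h := [EUR_{p,q}(b), EBL_{q,p}(b′)]. Suppose that [h, X_q] = X_q and [h, X_p] = (1 − δ_{q,p+1})·X_p, where X_j := EUL_{j,j+1}(1) for 1 ≤ j ≤ r−1 and X_r := Evert_r(√2·1) (with √2·1 the image of √2 ∈ ℂ in 𝔞). Then b′·b = 1 and b·b′ = 1; in particular b is invertible in 𝔞 with inverse b′. -/

import Mathlib

namespace GIMPaper

/-- The paper's `E_{i,j}(a)`: the `(2r+1) × (2r+1)` matrix over `A` whose entry at the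
(1-based) position `(i, j)` is `a` and all of whose other entries are `0`. -/
def E (A : Type*) [Ring A] (r i j : ℕ) (a : A) :
    Matrix (Fin (2 * r + 1)) (Fin (2 * r + 1)) A :=
  fun x y => if (x : ℕ) + 1 = i ∧ (y : ℕ) + 1 = j then a else 0

/-- `Evert_k(a) = E_{k,r+1}(a) + E_{r+1,2r+2-k}(-η a)`. -/
def Evert (A : Type*) [Ring A] (r : ℕ) (η : A → A) (k : ℕ) (a : A) :
    Matrix (Fin (2 * r + 1)) (Fin (2 * r + 1)) A :=
  E A r k (r + 1) a + E A r (r + 1) (2 * r + 2 - k) (-η a)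

/-- `Ehort_k(a) = E_{r+1,k}(a) + E_{2r+2-k,r+1}(-η a)`. -/
def Ehort (A : Type*) [Ring A] (r : ℕ) (η : A → A) (k : ℕ) (a : A) :
    Matrix (Fin (2 * r + 1)) (Fin (2 * r + 1)) A :=
  E A r (r + 1) k a + E A r (2 * r + 2 - k) (r + 1) (-η a)

/-- `EUL_{p,q}(a) = E_{p,q}(a) + E_{2r+2-q,2r+2-p}(-η a)`. -/
def EUL (A : Type*) [Ring A] (r : ℕ) (η : A → A) (p q : ℕ) (a : A) :
    Matrix (Fin (2 * r + 1)) (Fin (2 * r + 1)) A :=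
  E A r p q a + E A r (2 * r + 2 - q) (2 * r + 2 - p) (-η a)

/-- `EUR_{p,q}(a) = E_{p,2r+2-q}(a) + E_{q,2r+2-p}(-η a)`. -/
def EUR (A : Type*) [Ring A] (r : ℕ) (η : A → A) (p q : ℕ) (a : A) :
    Matrix (Fin (2 * r + 1)) (Fin (2 * r + 1)) A :=
  E A r p (2 * r + 2 - q) a + E A r q (2 * r + 2 - p) (-η a)

/-- `EBL_{p,q}(a) = E_{2r+2-p,q}(a) + E_{2r+2-q,p}(-η a)`. -/
def EBL (A : Type*) [Ring A] (r : ℕ) (η : A → A) (p q : ℕ) (a : A) :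
    Matrix (Fin (2 * r + 1)) (Fin (2 * r + 1)) A :=
  E A r (2 * r + 2 - p) q a + E A r (2 * r + 2 - q) p (-η a)

end GIMPaper

open GIMPaper

/-- `X_j := EUL_{j,j+1}(1)` for `j ≠ r` and `X_r := Evert_r(√2 · 1)`, where `√2 · 1` is the
image of `√2 ∈ ℂ` in `A`. -/
noncomputable def Xgen (A : Type*) [Ring A] [Algebra ℂ A] (r : ℕ) (η : A → A) (j : ℕ) :
    Matrix (Fin (2 * r + 1)) (Fin (2 * r + 1)) A :=
  if j = r then Evert A r η r (algebraMap ℂ A ((Real.sqrt 2 : ℝ) : ℂ))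
  else EUL A r η j (j + 1) (1 : A)

theorem E_mul_same (A : Type*) [Ring A] (r i j l : ℕ) (a b : A) (h1 : 1 ≤ j)
    (h2 : j ≤ 2 * r + 1) : E A r i j a * E A r j l b = E A r i l (a * b) := by
  ext x y
  rw [Matrix.mul_apply, Finset.sum_eq_single (⟨j - 1, by omega⟩ : Fin (2 * r + 1))]
  · have : j - 1 + 1 = j := by omega
    by_cases hx : (x : ℕ) + 1 = i <;> by_cases hy : (y : ℕ) + 1 = l <;> simp [E, hx, hy, this]
  · intro z _ hz
    have : ¬ ((z : ℕ) + 1 = j) := fun hc => hz (Fin.ext (by simp; omega))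
    simp [E, this]
  · simp

theorem E_mul_ne (A : Type*) [Ring A] (r i j k l : ℕ) (a b : A) (h : j ≠ k) :
    E A r i j a * E A r k l b = 0 := by
  ext x y
  rw [Matrix.mul_apply]
  apply Finset.sum_eq_zero
  intro z _
  by_cases hz : (z : ℕ) + 1 = j
  · have : ¬ ((z : ℕ) + 1 = k) := by omega
    simp [E, this]
  · simp [E, hz]

theorem stmt_15
    (r : ℕ) (hr : 3 ≤ r) (A : Type*) [Ring A] [Algebra ℂ A]
    (η : A → A)
    (hη_add : ∀ a b : A, η (a + b) = η a + η b)
    (hη_smul : ∀ (c : ℂ) (a : A), η (c • a) = c • η a)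
    (hη_mul : ∀ a b : A, η (a * b) = η b * η a)
    (hη_one : η (1 : A) = 1)
    (hη_invol : ∀ a : A, η (η a) = a)
    (p q : ℕ) (hp1 : 1 ≤ p) (hpq : p < q) (hqr : q ≤ r) (b b' : A)
    (h : Matrix (Fin (2 * r + 1)) (Fin (2 * r + 1)) A)
    (hh : h = EUR A r η p q b * EBL A r η q p b' - EBL A r η q p b' * EUR A r η p q b)
    (hXq : h * Xgen A r η q - Xgen A r η q * h = Xgen A r η q)
    (hXp : h * Xgen A r η p - Xgen A r η p * h
        = ((1 : ℤ) - (if q = p + 1 then 1 else 0)) • Xgen A r η p) :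
    b' * b = 1 ∧ b * b' = 1 := by
  have hz : η 0 = 0 := by simpa using hη_smul 0 0
  have hneg : ∀ a, η (-a) = -η a := fun a => by
    have := hη_smul (-1) a
    simpa using this
  have hd : h = E A r p p (b * b') + E A r q q (η (b' * b))
      - (E A r (2 * r + 2 - q) (2 * r + 2 - q) (b' * b)
        + E A r (2 * r + 2 - p) (2 * r + 2 - p) (η (b * b'))) := by
    rw [hh, EUR, EBL]
    simp only [mul_add, add_mul]
    rw [E_mul_same _ _ _ _ _ _ _ (by omega) (by omega),
      E_mul_same _ _ _ _ _ _ _ (by omega) (by omega),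
      E_mul_same _ _ _ _ _ _ _ (by omega) (by omega),
      E_mul_same _ _ _ _ _ _ _ (by omega) (by omega),
      E_mul_ne _ _ _ _ _ _ _ _ (by omega), E_mul_ne _ _ _ _ _ _ _ _ (by omega),
      E_mul_ne _ _ _ _ _ _ _ _ (by omega), E_mul_ne _ _ _ _ _ _ _ _ (by omega)]
    simp [hη_mul]
  obtain ⟨d, hdd⟩ : ∃ d : Fin (2 * r + 1) → A, d = fun x => h x x := ⟨_, rfl⟩
  have hdiag : h = Matrix.diagonal d := by
    ext x y
    by_cases hxy : x = y
    · subst hxy; simp [hdd]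
    · have : (x : ℕ) ≠ y := fun hc => hxy (Fin.ext hc)
      rw [Matrix.diagonal_apply_ne _ hxy, hd]
      have key : ∀ k (a : A), E A r k k a x y = 0 := fun k a => by
        unfold E
        exact if_neg (by omega)
      simp [key]
  have hent : ∀ (X : Matrix (Fin (2 * r + 1)) (Fin (2 * r + 1)) A) x y,
      (h * X - X * h) x y = d x * X x y - X x y * d y := fun X x y => by
    rw [hdiag]; simp [Matrix.diagonal_mul, Matrix.mul_diagonal]
  have hdp : d ⟨p - 1, by omega⟩ = b * b' := by
    have e1 : p - 1 + 1 = p := by omega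
    have e2 : p ≠ q := by omega
    have e3 : p ≠ 2 * r + 2 - p := by omega
    have e4 : p ≠ 2 * r + 2 - q := by omega
    rw [hdd, hd]; simp [E, e1, e2, e3, e4]
  have hdq : d ⟨q - 1, by omega⟩ = η (b' * b) := by
    have e1 : q - 1 + 1 = q := by omega
    have e2 : q ≠ p := by omega
    have e3 : q ≠ 2 * r + 2 - p := by omega
    have e4 : q ≠ 2 * r + 2 - q := by omega
    rw [hdd, hd]; simp [E, e1, e2, e3, e4]
  have hd0 : ∀ k (hk : k < 2 * r + 1), k ≤ r → k + 1 ≠ p → k + 1 ≠ q → d ⟨k, hk⟩ = 0 := by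
    intro k hk hkr e1 e2
    have e3 : k + 1 ≠ 2 * r + 2 - p := by omega
    have e4 : k + 1 ≠ 2 * r + 2 - q := by omega
    rw [hdd, hd]; simp [E, e1, e2]; simp [e3, e4]
  have hX : ∀ k (_ : 1 ≤ k) (_ : k < r),
      Xgen A r η k ⟨k - 1, by omega⟩ ⟨k, by omega⟩ = 1 := by
    intro k h1 h2
    have e1 : k - 1 + 1 = k := by omega
    have e2 : k ≠ r := by omega
    have e3 : k ≠ 2 * r + 2 - (k + 1) := by omega
    simp only [Xgen, if_neg e2, EUL, Matrix.add_apply, E, e1]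
    simp
    intro hc; omega
  have hXr : Xgen A r η r ⟨r - 1, by omega⟩ ⟨r, by omega⟩
      = algebraMap ℂ A ((Real.sqrt 2 : ℝ) : ℂ) := by
    have e1 : r - 1 + 1 = r := by omega
    simp [Xgen, Evert, E, e1]
  have hq1 : η (b' * b) = 1 := by
    have := congrFun (congrFun hXq ⟨q - 1, by omega⟩) ⟨q, by omega⟩
    rw [hent, hdq, hd0 q (by omega) (by omega) (by omega) (by omega)] at this
    by_cases hq : q = r
    · subst hq
      rw [hXr] at this
      have hs : ((Real.sqrt 2 : ℝ) : ℂ) ≠ 0 := by simp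
      have h2 := congrArg (· * algebraMap ℂ A (((Real.sqrt 2 : ℝ) : ℂ)⁻¹)) this
      simp only [mul_zero, sub_zero, mul_assoc, ← map_mul, mul_inv_cancel₀ hs, map_one,
        mul_one] at h2
      exact h2
    · rw [hX q (by omega) (by omega)] at this
      simpa using this
  have hbb : b' * b = 1 := by rw [← hη_invol (b' * b), hq1, hη_one]
  refine ⟨hbb, ?_⟩
  have := congrFun (congrFun hXp ⟨p - 1, by omega⟩) ⟨p, by omega⟩
  rw [hent, hdp, Matrix.smul_apply, hX p hp1 (by omega)] at this
  by_cases hc : q = p + 1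
  · have e : d ⟨p, by omega⟩ = η (b' * b) := by
      rw [← hdq]; congr 2; omega
    rw [e, hq1] at this
    simp [hc] at this
    exact sub_eq_zero.mp this
  · rw [hd0 p (by omega) (by omega) (by omega) (by omega)] at this
    simpa [hc] using this
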